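/- arXiv:1609.00234 — 9 statements merged into one kernel-verified Lean document; each statement's English description precedes it below -/
import Mathlib

section
/- Let n ≥ 1 be a natural number and let f : [0,1] → ℝ be a continuous convex function. Then for all x, y ∈ [0,1], ∑_{i=0}^{n} ∑_{j=0}^{n} [p_{n,i}(x) p_{n,j}(x) + p_{n,i}(y) p_{n,j}(y) − 2 p_{n,i}(x) p_{n,j}(y)] · f((i+j)/(2n)) ≥ 0. -/
/-- Bernstein basis polynomials: `p_{n,ν}(x) = C(n,ν) x^ν (1-x)^{n-ν}`;
note `Nat.choose n ν = 0` for `ν > n`, realizing the convention `p_{n,ν} = 0` for `ν > n`. -/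
noncomputable def bernsteinBasis (n ν : ℕ) (x : ℝ) : ℝ :=
  (n.choose ν : ℝ) * x ^ ν * (1 - x) ^ (n - ν)

open Polynomial

namespace Rasa

/-- The linear functional on polynomials sending `X ^ m` to `g m`. -/
noncomputable def moment (g : ℕ → ℝ) : ℝ[X] →ₗ[ℝ] ℝ :=
  Polynomial.lsum fun m => LinearMap.toSpanSingleton ℝ ℝ (g m)

lemma moment_monomial (g : ℕ → ℝ) (m : ℕ) (c : ℝ) : moment g (monomial m c) = c * g m := by
  simp [moment, Polynomial.lsum_apply]

lemma coeff_mul_nonneg {p q : ℝ[X]} (hp : ∀ m, 0 ≤ p.coeff m) (hq : ∀ m, 0 ≤ q.coeff m) (m : ℕ) :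
    0 ≤ (p * q).coeff m := by
  rw [coeff_mul]
  exact Finset.sum_nonneg fun _ _ => mul_nonneg (hp _) (hq _)

lemma coeff_pow_nonneg {p : ℝ[X]} (hp : ∀ m, 0 ≤ p.coeff m) (k m : ℕ) :
    0 ≤ (p ^ k).coeff m := by
  induction k generalizing m with
  | zero => rw [pow_zero, coeff_one]; split_ifs <;> norm_num
  | succ k ih => rw [pow_succ]; exact coeff_mul_nonneg ih hp m

/-- The probability generating function of a Bernoulli variable with parameter `x`. -/
noncomputable def bernoulliGF (x : ℝ) : ℝ[X] := C x * X + C (1 - x)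

lemma bernoulliGF_coeff_nonneg {x : ℝ} (hx : x ∈ Set.Icc (0 : ℝ) 1) (m : ℕ) :
    0 ≤ (bernoulliGF x).coeff m := by
  have h1 : 0 ≤ 1 - x := sub_nonneg.2 hx.2
  rw [bernoulliGF, coeff_add, coeff_C_mul, coeff_X, coeff_C]
  have := hx.1
  split_ifs <;> simp [this, h1]

lemma bernoulliGF_pow (n : ℕ) (x : ℝ) :
    bernoulliGF x ^ n = ∑ i ∈ Finset.range (n + 1), monomial i (bernsteinBasis n i x) := by
  rw [bernoulliGF, add_pow]
  refine Finset.sum_congr rfl fun i _ => ?_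
  rw [← C_mul_X_pow_eq_monomial, bernsteinBasis, mul_pow]
  simp only [C_mul, C_pow, map_natCast]
  ring

lemma moment_bernoulliGF_pow_mul (g : ℕ → ℝ) (n : ℕ) (x y : ℝ) :
    moment g (bernoulliGF x ^ n * bernoulliGF y ^ n) =
      ∑ i ∈ Finset.range (n + 1), ∑ j ∈ Finset.range (n + 1),
        bernsteinBasis n i x * bernsteinBasis n j y * g (i + j) := by
  simp only [bernoulliGF_pow, Finset.sum_mul_sum, map_sum, monomial_mul_monomial, moment_monomial]

lemma moment_sub_one_sq_mul_nonneg {g : ℕ → ℝ} {d : ℕ} {q : ℝ[X]} (hq : ∀ m, 0 ≤ q.coeff m)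
    (hd : q.natDegree < d) (hg : ∀ m < d, 0 ≤ g (m + 2) - 2 * g (m + 1) + g m) :
    0 ≤ moment g ((X - 1) ^ 2 * q) := by
  rw [q.as_sum_range' d hd, Finset.mul_sum, map_sum]
  refine Finset.sum_nonneg fun m hm => ?_
  have h : ((X - 1) ^ 2 * monomial m (q.coeff m) : ℝ[X]) =
      monomial (m + 2) (q.coeff m) - (2 : ℝ) • monomial (m + 1) (q.coeff m)
        + monomial m (q.coeff m) := by
    simp only [← C_mul_X_pow_eq_monomial, smul_eq_C_mul, map_ofNat]
    ring
  rw [h, map_add, map_sub, map_smul]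
  simp only [moment_monomial, smul_eq_mul]
  have := mul_nonneg (hq m) (hg m (Finset.mem_range.1 hm))
  linarith

lemma bernoulliGF_natDegree_le (x : ℝ) : (bernoulliGF x).natDegree ≤ 1 :=
  natDegree_linear_le

/-- `(aⁿ - bⁿ) / (a - b)` for the generating functions `a`, `b` of two Bernoulli variables. -/
noncomputable def geomSum (n : ℕ) (x y : ℝ) : ℝ[X] :=
  ∑ k ∈ Finset.range n, bernoulliGF x ^ k * bernoulliGF y ^ (n - 1 - k)

lemma geomSum_coeff_nonneg (n : ℕ) {x y : ℝ} (hx : x ∈ Set.Icc (0 : ℝ) 1)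
    (hy : y ∈ Set.Icc (0 : ℝ) 1) (m : ℕ) : 0 ≤ (geomSum n x y).coeff m := by
  rw [geomSum, finsetSum_coeff]
  exact Finset.sum_nonneg fun k _ => coeff_mul_nonneg
    (coeff_pow_nonneg (bernoulliGF_coeff_nonneg hx) _)
    (coeff_pow_nonneg (bernoulliGF_coeff_nonneg hy) _) m

lemma geomSum_natDegree_le (n : ℕ) (x y : ℝ) : (geomSum n x y).natDegree ≤ n - 1 := by
  refine natDegree_sum_le_of_forall_le _ _ fun k hk => ?_
  have hk := Finset.mem_range.1 hk
  refine (natDegree_mul_le_of_le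
    (natDegree_pow_le_of_le k (bernoulliGF_natDegree_le x))
    (natDegree_pow_le_of_le (n - 1 - k) (bernoulliGF_natDegree_le y))).trans ?_
  omega

lemma bernoulliGF_pow_sub_pow_sq (n : ℕ) (x y : ℝ) :
    (bernoulliGF x ^ n - bernoulliGF y ^ n) ^ 2 =
      (X - 1) ^ 2 * (C ((x - y) ^ 2) * geomSum n x y ^ 2) := by
  have h : bernoulliGF x - bernoulliGF y = C (x - y) * (X - 1) := by
    simp only [bernoulliGF, C_sub, C_1]
    ring
  rw [← (Commute.all (bernoulliGF x) (bernoulliGF y)).geom_sum₂_mul, ← geomSum, h, C_pow]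
  ring

lemma second_difference_nonneg {f : ℝ → ℝ} (hf : ConvexOn ℝ (Set.Icc 0 1) f) {n m : ℕ}
    (hm : m < 2 * n - 1) :
    0 ≤ f (((m + 2 : ℕ) : ℝ) / (2 * n)) - 2 * f (((m + 1 : ℕ) : ℝ) / (2 * n))
      + f ((m : ℝ) / (2 * n)) := by
  have hn : (0 : ℝ) < 2 * n := by
    have : 0 < n := by omega
    positivity
  have hmem : ∀ k : ℕ, k ≤ 2 * n → (k : ℝ) / (2 * n) ∈ Set.Icc (0 : ℝ) 1 := fun k hk =>
    ⟨by positivity, (div_le_one hn).2 (by exact_mod_cast hk)⟩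
  have h := hf.2 (hmem (m + 2) (by omega)) (hmem m (by omega))
    (by norm_num : (0 : ℝ) ≤ 1 / 2) (by norm_num : (0 : ℝ) ≤ 1 / 2) (by norm_num)
  have e : (1 / 2 : ℝ) • (((m + 2 : ℕ) : ℝ) / (2 * n)) + (1 / 2 : ℝ) • ((m : ℝ) / (2 * n)) =
      ((m + 1 : ℕ) : ℝ) / (2 * n) := by
    simp only [smul_eq_mul]
    push_cast
    ring
  rw [e] at h
  simp only [smul_eq_mul] at h
  linarith

end Rasa

theorem rasa_inequality_bernsteinBasis (n : ℕ) (hn : 1 ≤ n) (f : ℝ → ℝ)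
    (hf_cont : ContinuousOn f (Set.Icc 0 1)) (hf_conv : ConvexOn ℝ (Set.Icc 0 1) f)
    (x y : ℝ) (hx : x ∈ Set.Icc (0:ℝ) 1) (hy : y ∈ Set.Icc (0:ℝ) 1) :
    0 ≤ ∑ i ∈ Finset.range (n + 1), ∑ j ∈ Finset.range (n + 1),
      (bernsteinBasis n i x * bernsteinBasis n j x + bernsteinBasis n i y * bernsteinBasis n j y
        - 2 * bernsteinBasis n i x * bernsteinBasis n j y) * f ((i + j : ℝ) / (2 * n)) := by
  set g : ℕ → ℝ := fun m => f ((m : ℝ) / (2 * n)) with hg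
  have hdeg : (C ((x - y) ^ 2) * Rasa.geomSum n x y ^ 2).natDegree < 2 * n - 1 := by
    have h := (natDegree_C_mul_le ((x - y) ^ 2) (Rasa.geomSum n x y ^ 2)).trans
      (natDegree_pow_le_of_le 2 (Rasa.geomSum_natDegree_le n x y))
    omega
  have hcoeff : ∀ m, 0 ≤ (C ((x - y) ^ 2) * Rasa.geomSum n x y ^ 2).coeff m := fun m => by
    rw [coeff_C_mul]
    exact mul_nonneg (sq_nonneg _)
      (Rasa.coeff_pow_nonneg (Rasa.geomSum_coeff_nonneg n hx hy) 2 m)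
  have key : 0 ≤ Rasa.moment g ((Rasa.bernoulliGF x ^ n - Rasa.bernoulliGF y ^ n) ^ 2) := by
    rw [Rasa.bernoulliGF_pow_sub_pow_sq]
    exact Rasa.moment_sub_one_sq_mul_nonneg hcoeff hdeg
      fun m hm => Rasa.second_difference_nonneg hf_conv hm
  have hexpand : (Rasa.bernoulliGF x ^ n - Rasa.bernoulliGF y ^ n) ^ 2 =
      Rasa.bernoulliGF x ^ n * Rasa.bernoulliGF x ^ n
        + Rasa.bernoulliGF y ^ n * Rasa.bernoulliGF y ^ n
        - (2 : ℝ) • (Rasa.bernoulliGF x ^ n * Rasa.bernoulliGF y ^ n) := by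
    simp only [smul_eq_C_mul, map_ofNat]
    ring
  rw [hexpand, map_sub, map_add, map_smul] at key
  simp only [Rasa.moment_bernoulliGF_pow_mul, smul_eq_mul, Finset.mul_sum,
    ← Finset.sum_add_distrib, ← Finset.sum_sub_distrib] at key
  refine key.trans_eq (Finset.sum_congr rfl fun i _ => Finset.sum_congr rfl fun j _ => ?_)
  simp only [hg, Nat.cast_add]
  ring
end

section
/- Let n ≥ 1 be a natural number, let f : [0,1] → ℝ be any function, and let x, y be real numbers. Then ∑_{i=0}^{n} ∑_{j=0}^{n} [p_{n,i}(x) p_{n,j}(x) + p_{n,i}(y) p_{n,j}(y) − 2 p_{n,i}(x) p_{n,j}(y)] · f((i+j)/(2n)) = ∑_{k=0}^{2n} f(k/(2n)) · (1/k!) · [(d/dz)^k ((1+xz)^n − (1+yz)^n)^2] evaluated at z = −1. -/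
/-- Binomial expansion of `(1 + x * z) ^ n` in powers of `z + 1`. -/
theorem one_add_mul_pow_eq_sum_bernsteinBasis (n : ℕ) (x z : ℝ) :
    (1 + x * z) ^ n = ∑ i ∈ Finset.range (n + 1), bernsteinBasis n i x * (z + 1) ^ i := by
  rw [show 1 + x * z = x * (z + 1) + (1 - x) by ring, add_pow]
  refine Finset.sum_congr rfl fun i _ => ?_
  rw [bernsteinBasis, mul_pow]
  ring

theorem iteratedDeriv_add_one_pow_neg_one (k m : ℕ) :
    iteratedDeriv k (fun z : ℝ => (z + 1) ^ m) (-1) = if m = k then (k.factorial : ℝ) else 0 := by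
  rw [iteratedDeriv_comp_add_const k (fun z : ℝ => z ^ m) 1]
  simp only [iteratedDeriv_fun_pow_zero, neg_add_cancel]
  split_ifs <;> simp_all

theorem iteratedDeriv_sq_sum_neg_one (s : Finset ℕ) (a : ℕ → ℝ) (k : ℕ) :
    iteratedDeriv k (fun z : ℝ => (∑ i ∈ s, a i * (z + 1) ^ i) ^ 2) (-1)
      = ∑ i ∈ s, ∑ j ∈ s, a i * a j * if i + j = k then (k.factorial : ℝ) else 0 := by
  have h : (fun z : ℝ => (∑ i ∈ s, a i * (z + 1) ^ i) ^ 2)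
      = fun z => ∑ i ∈ s, ∑ j ∈ s, a i * a j * (z + 1) ^ (i + j) := by
    ext z
    rw [sq, Finset.sum_mul_sum]
    refine Finset.sum_congr rfl fun i _ => Finset.sum_congr rfl fun j _ => ?_
    ring
  rw [h, iteratedDeriv_fun_sum fun i _ => by fun_prop]
  refine Finset.sum_congr rfl fun i _ => ?_
  rw [iteratedDeriv_fun_sum fun j _ => by fun_prop]
  refine Finset.sum_congr rfl fun j _ => ?_
  rw [iteratedDeriv_const_mul_field, iteratedDeriv_add_one_pow_neg_one]

theorem bernstein_double_sum_eq (n : ℕ) (hn : 1 ≤ n) (f : ℝ → ℝ) (x y : ℝ) :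
    ∑ i ∈ Finset.range (n + 1), ∑ j ∈ Finset.range (n + 1),
      (bernsteinBasis n i x * bernsteinBasis n j x
        + bernsteinBasis n i y * bernsteinBasis n j y
        - 2 * bernsteinBasis n i x * bernsteinBasis n j y) * f ((i + j : ℝ) / (2 * n))
    = ∑ k ∈ Finset.range (2 * n + 1), f ((k : ℝ) / (2 * n)) * (1 / (Nat.factorial k : ℝ)) *
        iteratedDeriv k (fun z : ℝ => ((1 + x * z) ^ n - (1 + y * z) ^ n) ^ 2) (-1) := by
  set s := Finset.range (n + 1) with hs
  set a : ℕ → ℝ := fun i => bernsteinBasis n i x - bernsteinBasis n i y with ha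
  have hsymm : ∑ i ∈ s, ∑ j ∈ s, bernsteinBasis n i x * bernsteinBasis n j y
        * f ((i + j : ℝ) / (2 * n))
      = ∑ i ∈ s, ∑ j ∈ s, bernsteinBasis n i y * bernsteinBasis n j x
        * f ((i + j : ℝ) / (2 * n)) := by
    rw [Finset.sum_comm]
    refine Finset.sum_congr rfl fun i _ => Finset.sum_congr rfl fun j _ => ?_
    rw [add_comm (j : ℝ)]
    ring
  have hfun : (fun z : ℝ => ((1 + x * z) ^ n - (1 + y * z) ^ n) ^ 2)
      = fun z => (∑ i ∈ s, a i * (z + 1) ^ i) ^ 2 := by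
    ext z
    simp only [one_add_mul_pow_eq_sum_bernsteinBasis, ha, hs, sub_mul, Finset.sum_sub_distrib]
  calc
    _ = ∑ i ∈ s, ∑ j ∈ s, a i * a j * f ((i + j : ℝ) / (2 * n)) := by
      rw [← sub_eq_zero]
      trans ∑ i ∈ s, ∑ j ∈ s, bernsteinBasis n i y * bernsteinBasis n j x
            * f ((i + j : ℝ) / (2 * n))
          - ∑ i ∈ s, ∑ j ∈ s, bernsteinBasis n i x * bernsteinBasis n j y
            * f ((i + j : ℝ) / (2 * n))
      · simp only [← Finset.sum_sub_distrib]
        refine Finset.sum_congr rfl fun i _ => Finset.sum_congr rfl fun j _ => ?_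
        simp only [ha]
        ring
      · rw [hsymm, sub_self]
    _ = ∑ i ∈ s, ∑ j ∈ s, ∑ k ∈ Finset.range (2 * n + 1),
          f ((k : ℝ) / (2 * n)) * (1 / (Nat.factorial k : ℝ)) *
            (a i * a j * if i + j = k then (k.factorial : ℝ) else 0) := by
      refine Finset.sum_congr rfl fun i hi => Finset.sum_congr rfl fun j hj => ?_
      rw [hs, Finset.mem_range] at hi hj
      rw [Finset.sum_eq_single_of_mem (i + j) (Finset.mem_range.2 (by lia))
        fun k _ hk => by rw [if_neg hk.symm, mul_zero, mul_zero], if_pos rfl]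
      have := Nat.cast_ne_zero (R := ℝ).2 (i + j).factorial_ne_zero
      push_cast
      field_simp
    _ = _ := by
      simp only [hfun, iteratedDeriv_sq_sum_neg_one, Finset.mul_sum]
      rw [Finset.sum_comm (s := Finset.range (2 * n + 1))]
      exact Finset.sum_congr rfl fun i _ => Finset.sum_comm
end

section
/- Let n ≥ 1 be a natural number, let (a_k)_{k=0}^{2n} be a real sequence, and fix real numbers x, y. Let g be the polynomial in z satisfying z^2 · g(z) = ((1+xz)^n − (1+yz)^n)^2 (so g has degree at most 2n−2). Then ∑_{i=0}^{n} ∑_{j=0}^{n} [p_{n,i}(x) p_{n,j}(x) + p_{n,i}(y) p_{n,j}(y) − 2 p_{n,i}(x) p_{n,j}(y)] · a_{i+j} = ∑_{k=0}^{2n−2} (Δ²a_k) · (1/k!) · g^{(k)}(−1), where Δ²a_k = a_{k+2} − 2 a_{k+1} + a_k. -/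
open Polynomial

/-- The linear functional on `ℝ[X]` sending `X ^ k` to `a k`. -/
noncomputable def momentFunctional (a : ℕ → ℝ) : ℝ[X] →ₗ[ℝ] ℝ :=
  Polynomial.lsum fun k => a k • LinearMap.id

lemma momentFunctional_C_mul_X_pow (a : ℕ → ℝ) (c : ℝ) (k : ℕ) :
    momentFunctional a (C c * X ^ k) = c * a k := by
  rw [momentFunctional, C_mul_X_pow_eq_monomial, Polynomial.lsum_apply,
    sum_monomial_index _ _ (by simp)]
  simp [mul_comm]

lemma momentFunctional_sum_mul_sum (a u v : ℕ → ℝ) (s t : Finset ℕ) :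
    momentFunctional a ((∑ i ∈ s, C (u i) * X ^ i) * ∑ j ∈ t, C (v j) * X ^ j)
      = ∑ i ∈ s, ∑ j ∈ t, u i * v j * a (i + j) := by
  rw [Finset.sum_mul_sum, map_sum]
  refine Finset.sum_congr rfl fun i _ => ?_
  rw [map_sum]
  refine Finset.sum_congr rfl fun j _ => ?_
  rw [← momentFunctional_C_mul_X_pow, C_mul, pow_add]
  congr 1
  ring

lemma momentFunctional_X_sub_one_sq_mul (a b : ℕ → ℝ) (s : Finset ℕ) :
    momentFunctional a ((X - 1) ^ 2 * ∑ k ∈ s, C (b k) * X ^ k)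
      = ∑ k ∈ s, (a (k + 2) - 2 * a (k + 1) + a k) * b k := by
  rw [Finset.mul_sum, map_sum]
  refine Finset.sum_congr rfl fun k _ => ?_
  have h : (X - 1) ^ 2 * (C (b k) * X ^ k)
      = C (b k) * X ^ (k + 2) - (2 : ℝ) • (C (b k) * X ^ (k + 1)) + C (b k) * X ^ k := by
    rw [smul_eq_C_mul, C_ofNat]
    ring
  rw [h, map_add, map_sub, map_smul]
  simp only [momentFunctional_C_mul_X_pow, smul_eq_mul]
  ring

/-- The generating polynomial of the Bernstein basis. -/
lemma sum_bernsteinBasis_mul_X_pow (n : ℕ) (x : ℝ) :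
    ∑ i ∈ Finset.range (n + 1), C (bernsteinBasis n i x) * X ^ i
      = (1 + C x * (X - 1)) ^ n := by
  have h : (1 + C x * (X - 1) : ℝ[X]) = C x * X + C (1 - x) := by
    rw [C_sub, C_1]
    ring
  rw [h, add_pow]
  refine Finset.sum_congr rfl fun i _ => ?_
  simp only [bernsteinBasis, C_mul, C_pow, C_eq_natCast]
  ring

lemma coeff_taylor_eq_iterate_derivative (g : ℝ[X]) (r : ℝ) (k : ℕ) :
    (taylor r g).coeff k = 1 / (Nat.factorial k : ℝ) * (derivative^[k] g).eval r := by
  have hk : (Nat.factorial k : ℝ) ≠ 0 := by positivity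
  rw [taylor_coeff, ← factorial_smul_hasseDeriv, LinearMap.smul_apply, eval_smul, nsmul_eq_mul]
  field_simp

lemma natDegree_lt_of_X_sq_mul_eq (n : ℕ) (hn : 1 ≤ n) (x y : ℝ) (g : ℝ[X])
    (hg : X ^ 2 * g = ((1 + C x * X) ^ n - (1 + C y * X) ^ n) ^ 2) :
    g.natDegree < 2 * n - 1 := by
  by_cases h0 : g = 0
  · subst h0
    simp only [natDegree_zero]
    omega
  have hpow (t : ℝ) : ((1 + C t * X) ^ n : ℝ[X]).natDegree ≤ n := by
    refine natDegree_pow_le_of_le n (m := 1) ?_ |>.trans (by omega)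
    compute_degree
  have h1 : (X ^ 2 * g).natDegree ≤ 2 * n := by
    rw [hg]
    exact natDegree_pow_le_of_le 2 (natDegree_sub_le_of_le (hpow x) (hpow y)) |>.trans (by simp)
  rw [natDegree_X_pow_mul 2 h0] at h1
  omega

theorem bernstein_key_identity (n : ℕ) (hn : 1 ≤ n) (a : ℕ → ℝ) (x y : ℝ)
    (g : Polynomial ℝ)
    (hg : (X : Polynomial ℝ) ^ 2 * g
        = ((1 + C x * X) ^ n - (1 + C y * X) ^ n) ^ 2) :
    ∑ i ∈ Finset.range (n + 1), ∑ j ∈ Finset.range (n + 1),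
      (bernsteinBasis n i x * bernsteinBasis n j x
        + bernsteinBasis n i y * bernsteinBasis n j y
        - 2 * bernsteinBasis n i x * bernsteinBasis n j y) * a (i + j)
    = ∑ k ∈ Finset.range (2 * n - 1),
        (a (k + 2) - 2 * a (k + 1) + a k) * (1 / (Nat.factorial k : ℝ)) *
          (derivative^[k] g).eval (-1) := by
  have hshift : ((1 + C x * (X - 1)) ^ n - (1 + C y * (X - 1)) ^ n) ^ 2
      = (X - 1) ^ 2 * taylor (-1) g := by
    have h := congrArg (fun p : ℝ[X] => p.comp (X + C (-1))) hg
    simp only [mul_comp, pow_comp, sub_comp, add_comp, X_comp, C_comp, one_comp, C_neg, C_1,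
      ← sub_eq_add_neg] at h
    rw [← h, taylor_apply, C_neg, C_1, ← sub_eq_add_neg]
  have hsum : taylor (-1) g = ∑ k ∈ Finset.range (2 * n - 1),
      C (1 / (Nat.factorial k : ℝ) * (derivative^[k] g).eval (-1)) * X ^ k := by
    rw [(taylor (-1) g).as_sum_range_C_mul_X_pow' (n := 2 * n - 1)
      (by rw [natDegree_taylor]; exact natDegree_lt_of_X_sq_mul_eq n hn x y g hg)]
    simp only [coeff_taylor_eq_iterate_derivative]
  have hL := congrArg (momentFunctional a) hshift
  rw [hsum, momentFunctional_X_sub_one_sq_mul] at hL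
  simp only [mul_assoc (_ + a _)]
  rw [← hL]
  have hexp (p q : ℝ[X]) : (p - q) ^ 2 = p * p + q * q - (2 : ℝ) • (p * q) := by
    rw [smul_eq_C_mul, C_ofNat]
    ring
  rw [hexp, map_sub, map_add, map_smul]
  simp only [← sum_bernsteinBasis_mul_X_pow, momentFunctional_sum_mul_sum]
  simp only [smul_eq_mul,
    Finset.mul_sum, ← Finset.sum_add_distrib, ← Finset.sum_sub_distrib]
  refine Finset.sum_congr rfl fun i _ => Finset.sum_congr rfl fun j _ => ?_
  ring
end

section
/- Let n ≥ 1 be a natural number and let x, y ∈ [0,1]. Let g be the polynomial in z satisfying z^2 · g(z) = ((1+xz)^n − (1+yz)^n)^2. Then g^{(k)}(−1) ≥ 0 for every k with 0 ≤ k ≤ 2n−2. -/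
open Polynomial

theorem mem_lifts_toRealHom_iff {p : ℝ[X]} :
    p ∈ lifts NNReal.toRealHom ↔ ∀ k, 0 ≤ p.coeff k := by
  rw [lifts_iff_coeff_lifts]
  refine forall_congr' fun k => ⟨?_, fun h => ⟨⟨_, h⟩, rfl⟩⟩
  rintro ⟨a, ha⟩
  exact ha ▸ a.2

theorem eval_iterate_derivative_eq_factorial_mul_coeff_taylor (p : ℝ[X]) (r : ℝ) (k : ℕ) :
    (derivative^[k] p).eval r = k.factorial * (taylor r p).coeff k := by
  rw [← factorial_smul_hasseDeriv, taylor_coeff]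
  simp

theorem taylor_neg_one_one_add_mem_lifts {x : ℝ} (hx : x ∈ Set.Icc (0 : ℝ) 1) :
    taylor (-1) (1 + C x * X) ∈ lifts NNReal.toRealHom := by
  have h : taylor (-1) (1 + C x * X) = C (1 - x) + C x * X := by
    simp only [map_add, taylor_one, taylor_mul, taylor_C, taylor_X, C_sub, C_neg, C_1]
    ring
  rw [h]
  exact add_mem (C'_mem_lifts (f := NNReal.toRealHom) ⟨⟨1 - x, sub_nonneg.2 hx.2⟩, rfl⟩)
    (mul_mem (C'_mem_lifts (f := NNReal.toRealHom) ⟨⟨x, hx.1⟩, rfl⟩) (X_mem_lifts _))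

theorem bernstein_quotient_deriv_nonneg (n : ℕ) (hn : 1 ≤ n) (x y : ℝ)
    (hx : x ∈ Set.Icc (0:ℝ) 1) (hy : y ∈ Set.Icc (0:ℝ) 1)
    (g : Polynomial ℝ)
    (hg : (X : Polynomial ℝ) ^ 2 * g
        = ((1 + C x * X) ^ n - (1 + C y * X) ^ n) ^ 2) :
    ∀ k ≤ 2 * n - 2, 0 ≤ (derivative^[k] g).eval (-1) := by
  intro k _
  have hgS : g = C ((x - y) ^ 2) *
      (∑ i ∈ Finset.range n, (1 + C x * X) ^ i * (1 + C y * X) ^ (n - 1 - i)) ^ 2 := by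
    refine mul_left_cancel₀ (pow_ne_zero 2 X_ne_zero) ?_
    rw [hg, ← (Commute.all _ _).geom_sum₂_mul, C_pow, C_sub]
    ring
  rw [eval_iterate_derivative_eq_factorial_mul_coeff_taylor]
  refine mul_nonneg (Nat.cast_nonneg _) (mem_lifts_toRealHom_iff.1 ?_ k)
  rw [hgS, taylor_mul, taylor_C, taylor_pow, map_sum]
  refine mul_mem (C'_mem_lifts (f := NNReal.toRealHom) ⟨⟨_, sq_nonneg _⟩, rfl⟩)
    (pow_mem (sum_mem fun i _ => ?_) 2)
  rw [taylor_mul, taylor_pow, taylor_pow]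
  exact mul_mem (pow_mem (taylor_neg_one_one_add_mem_lifts hx) _)
    (pow_mem (taylor_neg_one_one_add_mem_lifts hy) _)
end

section
/- If f : [0,∞) → ℝ is a continuous convex function of at most exponential growth (i.e., there exist constants A, B > 0 with |f(t)| ≤ A·e^{B t} for all t ≥ 0), then for all x, y ∈ [0,∞), ∑_{i=0}^{∞} ∑_{j=0}^{∞} [s_i(x) s_j(x) + s_i(y) s_j(y) − 2 s_i(x) s_j(y)] · f(i+j) ≥ 0. -/
/-- Mirakyan–Favard–Szász basis functions: `s_ν(x) = e^{-x} x^ν / ν!`. -/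
noncomputable def szaszBasis (ν : ℕ) (x : ℝ) : ℝ :=
  Real.exp (-x) * x ^ ν / (Nat.factorial ν : ℝ)

/-- Sequences that grow at most geometrically. -/
def GeomBounded (a : ℕ → ℝ) : Prop :=
  ∃ A C : ℝ, 0 ≤ A ∧ 0 ≤ C ∧ ∀ n, |a n| ≤ A * C ^ n

/-- The Poisson semigroup acting on sequences. -/
noncomputable def poissonOp (t : ℝ) (a : ℕ → ℝ) (n : ℕ) : ℝ :=
  ∑' k : ℕ, szaszBasis k t * a (n + k)

theorem szaszBasis_nonneg {t : ℝ} (ht : 0 ≤ t) (k : ℕ) : 0 ≤ szaszBasis k t := by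
  unfold szaszBasis
  positivity

theorem hasSum_szaszBasis_mul_pow (t C : ℝ) :
    HasSum (fun k => szaszBasis k t * C ^ k) (Real.exp (-t) * Real.exp (t * C)) := by
  have h := (NormedSpace.expSeries_div_hasSum_exp (t * C)).mul_left (Real.exp (-t))
  rw [← Real.exp_eq_exp_ℝ] at h
  refine (congrArg (HasSum · _) (funext fun k => ?_)).mpr h
  simp only [szaszBasis, mul_pow]
  ring

theorem hasSum_szaszBasis (t : ℝ) : HasSum (fun k => szaszBasis k t) 1 := by
  have h := hasSum_szaszBasis_mul_pow t 1
  rw [← Real.exp_add] at h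
  simpa using h

theorem sum_antidiagonal_szaszBasis (s t : ℝ) (n : ℕ) :
    ∑ p ∈ Finset.HasAntidiagonal.antidiagonal n, szaszBasis p.1 s * szaszBasis p.2 t = szaszBasis n (s + t) := by
  unfold szaszBasis
  rw [(Commute.all s t).add_pow', neg_add, Real.exp_add, Finset.mul_sum, Finset.sum_div]
  refine Finset.sum_congr rfl fun p hp => ?_
  have hpn : p.1 + p.2 = n := Finset.HasAntidiagonal.mem_antidiagonal.mp hp
  have hc : (n.choose p.1 : ℝ) * (p.1.factorial * p.2.factorial) = n.factorial := by
    have := Nat.add_choose_mul_factorial_mul_factorial p.1 p.2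
    rw [← Nat.choose_symm_add, hpn] at this
    rw [← mul_assoc]
    exact_mod_cast this
  have h1 : (p.1.factorial : ℝ) ≠ 0 := by positivity
  have h2 : (p.2.factorial : ℝ) ≠ 0 := by positivity
  have h3 : (n.factorial : ℝ) ≠ 0 := by positivity
  rw [nsmul_eq_mul]
  field_simp
  rw [← hc]
  ring

theorem GeomBounded.norm_term_le {a : ℕ → ℝ} {A C : ℝ} (h : ∀ n, |a n| ≤ A * C ^ n)
    {t : ℝ} (ht : 0 ≤ t) (n k : ℕ) :
    ‖szaszBasis k t * a (n + k)‖ ≤ A * C ^ n * (szaszBasis k t * C ^ k) := by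
  rw [Real.norm_eq_abs, abs_mul, abs_of_nonneg (szaszBasis_nonneg ht k)]
  calc _ ≤ szaszBasis k t * (A * C ^ (n + k)) :=
        mul_le_mul_of_nonneg_left (h _) (szaszBasis_nonneg ht k)
    _ = _ := by rw [pow_add]; ring

theorem GeomBounded.summable {a : ℕ → ℝ} (ha : GeomBounded a) {t : ℝ} (ht : 0 ≤ t) (n : ℕ) :
    Summable fun k => szaszBasis k t * a (n + k) := by
  obtain ⟨A, C, -, -, h⟩ := ha
  exact Summable.of_norm_bounded ((hasSum_szaszBasis_mul_pow t C).summable.mul_left (A * C ^ n))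
    (GeomBounded.norm_term_le h ht n)

theorem GeomBounded.poissonOp {a : ℕ → ℝ} (ha : GeomBounded a) {t : ℝ} (ht : 0 ≤ t) :
    GeomBounded (poissonOp t a) := by
  obtain ⟨A, C, hA, hC, h⟩ := ha
  refine ⟨A * (Real.exp (-t) * Real.exp (t * C)), C, by positivity, hC, fun n => ?_⟩
  have := tsum_of_norm_bounded ((hasSum_szaszBasis_mul_pow t C).mul_left (A * C ^ n))
    (GeomBounded.norm_term_le h ht n)
  calc _ ≤ _ := this
    _ = _ := by ring

theorem GeomBounded.sub {a b : ℕ → ℝ} (ha : GeomBounded a) (hb : GeomBounded b) :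
    GeomBounded (a - b) := by
  obtain ⟨A, C, hA, hC, h⟩ := ha
  obtain ⟨B, D, hB, hD, h'⟩ := hb
  refine ⟨A + B, max C D, by positivity, by positivity, fun n => ?_⟩
  calc |a n - b n| ≤ |a n| + |b n| := abs_sub _ _
    _ ≤ A * C ^ n + B * D ^ n := add_le_add (h n) (h' n)
    _ ≤ A * max C D ^ n + B * max C D ^ n := by
        gcongr
        · exact le_max_left _ _
        · exact le_max_right _ _
    _ = _ := by ring

theorem GeomBounded.shift {a : ℕ → ℝ} (ha : GeomBounded a) :
    GeomBounded fun n => a (n + 1) := by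
  obtain ⟨A, C, hA, hC, h⟩ := ha
  refine ⟨A * C, C, by positivity, hC, fun n => (h (n + 1)).trans_eq ?_⟩
  ring

theorem poissonOp_sub {a b : ℕ → ℝ} (ha : GeomBounded a) (hb : GeomBounded b) {t : ℝ}
    (ht : 0 ≤ t) (n : ℕ) : poissonOp t (a - b) n = poissonOp t a n - poissonOp t b n := by
  unfold poissonOp
  rw [← (ha.summable ht n).tsum_sub (hb.summable ht n)]
  simp only [Pi.sub_apply, mul_sub]

theorem poissonOp_poissonOp {a : ℕ → ℝ} (ha : GeomBounded a) {s t : ℝ} (hs : 0 ≤ s) (ht : 0 ≤ t)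
    (n : ℕ) : poissonOp s (poissonOp t a) n = poissonOp (s + t) a n := by
  let F : ℕ × ℕ → ℝ := fun p => szaszBasis p.1 s * (szaszBasis p.2 t * a (n + p.1 + p.2))
  have hF : Summable F := by
    obtain ⟨A, C, hA, hC, h⟩ := ha
    have hprod := ((hasSum_szaszBasis_mul_pow s C).summable.mul_of_nonneg
      (hasSum_szaszBasis_mul_pow t C).summable
      (fun k => mul_nonneg (szaszBasis_nonneg hs k) (by positivity))
      (fun k => mul_nonneg (szaszBasis_nonneg ht k) (by positivity))).mul_left (A * C ^ n)
    refine Summable.of_norm_bounded hprod fun p => ?_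
    rw [norm_mul, Real.norm_eq_abs, abs_of_nonneg (szaszBasis_nonneg hs p.1)]
    calc _ ≤ szaszBasis p.1 s * (A * C ^ (n + p.1) * (szaszBasis p.2 t * C ^ p.2)) :=
          mul_le_mul_of_nonneg_left (GeomBounded.norm_term_le h ht _ _) (szaszBasis_nonneg hs p.1)
      _ = _ := by rw [pow_add]; ring
  have hleft : poissonOp s (poissonOp t a) n = ∑' p, F p := by
    rw [hF.tsum_prod]
    simp only [F, poissonOp, tsum_mul_left]
  have hsigma : Summable fun c => F (Finset.HasAntidiagonal.sigmaAntidiagonalEquivProd c) :=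
    Finset.HasAntidiagonal.sigmaAntidiagonalEquivProd.summable_iff.mpr hF
  rw [hleft, ← Finset.HasAntidiagonal.sigmaAntidiagonalEquivProd.tsum_eq F, hsigma.tsum_sigma]
  refine tsum_congr fun k => ?_
  rw [tsum_fintype, ← sum_antidiagonal_szaszBasis, Finset.sum_mul,
    ← Finset.sum_coe_sort (Finset.HasAntidiagonal.antidiagonal k)]
  refine Finset.sum_congr rfl fun p _ => ?_
  have hp : p.1.1 + p.1.2 = k := Finset.HasAntidiagonal.mem_antidiagonal.mp p.2
  simp only [F, Finset.HasAntidiagonal.sigmaAntidiagonalEquivProd_apply]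
  rw [add_assoc, hp, mul_assoc]

theorem le_poissonOp_of_monotone {a : ℕ → ℝ} (ha : GeomBounded a) (hmono : Monotone a) {t : ℝ}
    (ht : 0 ≤ t) (n : ℕ) : a n ≤ poissonOp t a n := by
  have h := (hasSum_szaszBasis t).mul_right (a n)
  rw [one_mul] at h
  exact hasSum_le (fun k => mul_le_mul_of_nonneg_left (hmono (Nat.le_add_right n k))
    (szaszBasis_nonneg ht k)) h (ha.summable ht n).hasSum

theorem monotone_poissonOp_sub {a : ℕ → ℝ} (ha : GeomBounded a)
    (hconv : Monotone fun n => a (n + 1) - a n) {t : ℝ} (ht : 0 ≤ t) :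
    Monotone (poissonOp t a - a) := by
  refine monotone_nat_of_le_succ fun n => ?_
  have h := le_poissonOp_of_monotone (ha.shift.sub ha) hconv ht n
  rw [poissonOp_sub ha.shift ha ht] at h
  have hshift : poissonOp t (fun n => a (n + 1)) n = poissonOp t a (n + 1) :=
    tsum_congr fun k => by rw [add_right_comm]
  rw [hshift] at h
  simp only [Pi.sub_apply] at h ⊢
  linarith

/-- Midpoint convexity of the Szász transform of a convex sequence. -/
theorem two_mul_poissonOp_add_le {a : ℕ → ℝ} (ha : GeomBounded a)
    (hconv : Monotone fun n => a (n + 1) - a n) {s d : ℝ} (hs : 0 ≤ s) (hd : 0 ≤ d) (n : ℕ) :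
    2 * poissonOp (s + d) a n ≤ poissonOp s a n + poissonOp (s + d + d) a n := by
  have hTa := ha.poissonOp hd
  have hb := hTa.sub ha
  have hc : ∀ m, 0 ≤ (poissonOp d (poissonOp d a - a) - (poissonOp d a - a)) m := fun m =>
    sub_nonneg.mpr (le_poissonOp_of_monotone hb (monotone_poissonOp_sub ha hconv hd) hd m)
  have h : 0 ≤ poissonOp s (poissonOp d (poissonOp d a - a) - (poissonOp d a - a)) n :=
    tsum_nonneg fun k => mul_nonneg (szaszBasis_nonneg hs k) (hc _)
  rw [poissonOp_sub (hb.poissonOp hd) hb hs, poissonOp_poissonOp hb hs hd,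
    poissonOp_sub hTa ha (by positivity), poissonOp_sub hTa ha hs,
    poissonOp_poissonOp ha (by positivity) hd, poissonOp_poissonOp ha hs hd] at h
  linarith

theorem ConvexOn.monotone_forwardDiff_natCast {f : ℝ → ℝ} (hf : ConvexOn ℝ (Set.Ici 0) f) :
    Monotone fun n : ℕ => f (n + 1 : ℕ) - f n := by
  refine monotone_nat_of_le_succ fun n => ?_
  have h := hf.2 (Set.mem_Ici.mpr (n.cast_nonneg : (0 : ℝ) ≤ n))
    (Set.mem_Ici.mpr ((n + 1 + 1).cast_nonneg : (0 : ℝ) ≤ (n + 1 + 1 : ℕ)))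
    (by norm_num : (0 : ℝ) ≤ 1 / 2) (by norm_num : (0 : ℝ) ≤ 1 / 2) (by norm_num)
  have hmid : (1 / 2 : ℝ) • (n : ℝ) + (1 / 2 : ℝ) • ((n + 1 + 1 : ℕ) : ℝ) = ((n + 1 : ℕ) : ℝ) := by
    simp only [smul_eq_mul]
    push_cast
    ring
  rw [hmid] at h
  simp only [smul_eq_mul] at h
  linarith

theorem tsum_tsum_szaszBasis_eq {a : ℕ → ℝ} (ha : GeomBounded a) {x y : ℝ} (hx : 0 ≤ x)
    (hy : 0 ≤ y) :
    ∑' (i : ℕ), ∑' (j : ℕ),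
      (szaszBasis i x * szaszBasis j x + szaszBasis i y * szaszBasis j y
        - 2 * szaszBasis i x * szaszBasis j y) * a (i + j) =
      poissonOp (x + x) a 0 + poissonOp (y + y) a 0 - 2 * poissonOp (x + y) a 0 := by
  have hin : ∀ i, ∑' (j : ℕ),
      (szaszBasis i x * szaszBasis j x + szaszBasis i y * szaszBasis j y
        - 2 * szaszBasis i x * szaszBasis j y) * a (i + j) =
      szaszBasis i x * poissonOp x a (0 + i) + szaszBasis i y * poissonOp y a (0 + i)
        - 2 * (szaszBasis i x * poissonOp y a (0 + i)) := fun i => by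
    rw [zero_add]
    have hX := (ha.summable hx i).hasSum
    have hY := (ha.summable hy i).hasSum
    refine HasSum.tsum_eq ?_
    refine (congrArg (HasSum · _) (funext fun j => ?_)).mpr (((hX.mul_left (szaszBasis i x)).add
      (hY.mul_left (szaszBasis i y))).sub ((hY.mul_left (szaszBasis i x)).mul_left 2))
    ring
  rw [tsum_congr hin, ← poissonOp_poissonOp ha hx hx, ← poissonOp_poissonOp ha hy hy,
    ← poissonOp_poissonOp ha hx hy]
  exact ((((ha.poissonOp hx).summable hx 0).hasSum.add
    ((ha.poissonOp hy).summable hy 0).hasSum).sub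
    (((ha.poissonOp hy).summable hx 0).hasSum.mul_left 2)).tsum_eq

theorem rasa_inequality_szasz (f : ℝ → ℝ)
    (hf_cont : ContinuousOn f (Set.Ici 0)) (hf_conv : ConvexOn ℝ (Set.Ici 0) f)
    (hf_growth : ∃ A B : ℝ, 0 < A ∧ 0 < B ∧ ∀ t : ℝ, 0 ≤ t → |f t| ≤ A * Real.exp (B * t))
    (x y : ℝ) (hx : 0 ≤ x) (hy : 0 ≤ y) :
    0 ≤ ∑' (i : ℕ), ∑' (j : ℕ),
      (szaszBasis i x * szaszBasis j x + szaszBasis i y * szaszBasis j y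
        - 2 * szaszBasis i x * szaszBasis j y) * f (i + j : ℕ) := by
  have ha : GeomBounded fun n : ℕ => f n := by
    obtain ⟨A, B, hA, -, h⟩ := hf_growth
    refine ⟨A, Real.exp B, hA.le, (Real.exp_pos B).le, fun n => ?_⟩
    rw [← Real.exp_nat_mul, mul_comm (n : ℝ)]
    exact h n n.cast_nonneg
  have hconv := hf_conv.monotone_forwardDiff_natCast
  rw [tsum_tsum_szaszBasis_eq (a := fun n : ℕ => f n) ha hx hy]
  rcases le_total x y with hxy | hxy
  · have h := two_mul_poissonOp_add_le ha hconv (add_nonneg hx hx) (sub_nonneg.mpr hxy) 0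
    rw [show x + x + (y - x) = x + y by ring, show x + y + (y - x) = y + y by ring] at h
    linarith
  · have h := two_mul_poissonOp_add_le ha hconv (add_nonneg hy hy) (sub_nonneg.mpr hxy) 0
    rw [show y + y + (x - y) = x + y by ring, show x + y + (x - y) = x + x by ring] at h
    linarith
end

section
/- Fix real numbers x, y ≥ 0 and define g : ℝ → ℝ by g(z) = ((e^{xz} − e^{yz})/z)^2 for z ≠ 0 and g(0) = (x−y)^2 (the continuous extension). Then for every natural number k, the k-th derivative of g at z = −1 satisfies g^{(k)}(−1) = ∫_x^y ∫_x^y (u+v)^k e^{−(u+v)} du dv, and in particular g^{(k)}(−1) ≥ 0. -/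
open MeasureTheory in
/-- Differentiation under the interval integral for a jointly continuous derivative. -/
theorem hasDerivAt_intervalIntegral_of_continuous {F F' : ℝ → ℝ → ℝ} (a b : ℝ)
    (hF : ∀ z, Continuous (F z)) (hF' : Continuous (Function.uncurry F'))
    (h : ∀ z u, HasDerivAt (fun w => F w u) (F' z u) z) (z : ℝ) :
    HasDerivAt (fun w => ∫ u in a..b, F w u) (∫ u in a..b, F' z u) z := by
  obtain ⟨C, hC⟩ := ((isCompact_closedBall z 1).prod
    (isCompact_uIcc (a := a) (b := b))).exists_bound_of_continuousOn hF'.continuousOn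
  refine (intervalIntegral.hasDerivAt_integral_of_dominated_loc_of_deriv_le
    (μ := volume) (F := F) (F' := F') (bound := fun _ => C)
    (Metric.closedBall_mem_nhds z one_pos)
    (Filter.Eventually.of_forall fun w => (hF w).aestronglyMeasurable)
    ((hF z).intervalIntegrable a b)
    (hF'.comp (Continuous.prodMk_right z)).aestronglyMeasurable
    (Filter.Eventually.of_forall fun u hu w hw => ?_)
    intervalIntegrable_const
    (Filter.Eventually.of_forall fun u _ w _ => h w u)).2
  exact hC (w, u) ⟨hw, Set.uIoc_subset_uIcc hu⟩

/-- Iterated `z`-derivatives of the double integral of `exp (z * (u + v))`. -/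
theorem iteratedDeriv_doubleIntegral_exp (x y : ℝ) (k : ℕ) :
    iteratedDeriv k (fun z : ℝ => ∫ u in x..y, ∫ v in x..y, Real.exp (z * (u + v)))
      = fun z => ∫ u in x..y, ∫ v in x..y, (u + v) ^ k * Real.exp (z * (u + v)) := by
  induction k with
  | zero => simp
  | succ k ih =>
    rw [iteratedDeriv_succ, ih]
    funext z
    refine (hasDerivAt_intervalIntegral_of_continuous x y
      (F := fun z u => ∫ v in x..y, (u + v) ^ k * Real.exp (z * (u + v)))
      (F' := fun z u => ∫ v in x..y, (u + v) ^ (k + 1) * Real.exp (z * (u + v)))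
      (fun w => ?_) ?_ (fun w u => ?_) z).deriv
    · exact intervalIntegral.continuous_parametric_intervalIntegral_of_continuous'
        (by fun_prop) x y
    · exact intervalIntegral.continuous_parametric_intervalIntegral_of_continuous'
        (f := fun (p : ℝ × ℝ) v => (p.2 + v) ^ (k + 1) * Real.exp (p.1 * (p.2 + v)))
        (by fun_prop) x y
    · refine hasDerivAt_intervalIntegral_of_continuous x y
        (F := fun z v => (u + v) ^ k * Real.exp (z * (u + v)))
        (F' := fun z v => (u + v) ^ (k + 1) * Real.exp (z * (u + v)))
        (fun w => by fun_prop) (by fun_prop) (fun w v => ?_) w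
      exact (((hasDerivAt_mul_const (u + v)).exp.const_mul ((u + v) ^ k))).congr_deriv (by ring)

/-- The double integral of `exp (z * (u + v))` in closed form. -/
theorem doubleIntegral_exp_eq (x y z : ℝ) :
    ∫ u in x..y, ∫ v in x..y, Real.exp (z * (u + v))
      = if z = 0 then (x - y) ^ 2 else ((Real.exp (x * z) - Real.exp (y * z)) / z) ^ 2 := by
  split_ifs with hz
  · simp only [hz, zero_mul, Real.exp_zero, intervalIntegral.integral_const, smul_eq_mul]
    ring
  · have h : ∫ u in x..y, Real.exp (z * u) = (Real.exp (y * z) - Real.exp (x * z)) / z := by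
      rw [intervalIntegral.integral_comp_mul_left _ hz, integral_exp, smul_eq_mul,
        mul_comm z y, mul_comm z x, inv_mul_eq_div]
    simp only [mul_add, Real.exp_add, intervalIntegral.integral_const_mul,
      intervalIntegral.integral_mul_const, h]
    ring

/-- A double integral over the same oriented interval of a function that is nonnegative there
is nonnegative, whichever the orientation. -/
theorem doubleIntegral_nonneg {f : ℝ → ℝ → ℝ} (x y : ℝ)
    (hf : ∀ u ∈ Set.uIcc x y, ∀ v ∈ Set.uIcc x y, 0 ≤ f u v) :
    0 ≤ ∫ u in x..y, ∫ v in x..y, f u v := by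
  rcases le_total x y with h | h
  · rw [Set.uIcc_of_le h] at hf
    exact intervalIntegral.integral_nonneg h fun u hu =>
      intervalIntegral.integral_nonneg h fun v hv => hf u hu v hv
  · rw [Set.uIcc_of_ge h] at hf
    simp only [intervalIntegral.integral_symm y x, intervalIntegral.integral_neg, neg_neg]
    exact intervalIntegral.integral_nonneg h fun u hu =>
      intervalIntegral.integral_nonneg h fun v hv => hf u hu v hv

theorem szasz_g_deriv_eq_integral (x y : ℝ) (hx : 0 ≤ x) (hy : 0 ≤ y)
    (g : ℝ → ℝ)
    (hg : ∀ z : ℝ, g z = if z = 0 then (x - y) ^ 2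
        else ((Real.exp (x * z) - Real.exp (y * z)) / z) ^ 2) :
    ∀ k : ℕ,
      (iteratedDeriv k g (-1)
        = ∫ u in x..y, ∫ v in x..y, (u + v) ^ k * Real.exp (-(u + v))) ∧
      0 ≤ iteratedDeriv k g (-1) := by
  intro k
  have hgI : g = fun z => ∫ u in x..y, ∫ v in x..y, Real.exp (z * (u + v)) :=
    funext fun z => (hg z).trans (doubleIntegral_exp_eq x y z).symm
  have key : iteratedDeriv k g (-1)
      = ∫ u in x..y, ∫ v in x..y, (u + v) ^ k * Real.exp (-(u + v)) := by
    rw [hgI, iteratedDeriv_doubleIntegral_exp]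
    simp only [neg_one_mul]
  refine ⟨key, key ▸ doubleIntegral_nonneg x y fun u hu v hv => ?_⟩
  have hu0 : 0 ≤ u := (le_min hx hy).trans hu.1
  have hv0 : 0 ≤ v := (le_min hx hy).trans hv.1
  positivity
end

section
/- Let n ≥ 1 be a natural number. If f : [0,∞) → ℝ is a continuous convex function of at most polynomial growth (i.e., there exist constants A > 0 and m ∈ ℕ with |f(t)| ≤ A·(1+t)^m for all t ≥ 0), then for all x, y ∈ [0,∞), ∑_{i=0}^{∞} ∑_{j=0}^{∞} [b_{n,i}(x) b_{n,j}(x) + b_{n,i}(y) b_{n,j}(y) − 2 b_{n,i}(x) b_{n,j}(y)] · f(i+j) ≥ 0. -/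
/-- Baskakov basis functions: `b_{n,ν}(x) = C(n+ν-1, ν) x^ν / (1+x)^{n+ν}`. -/
noncomputable def baskakovBasis (n ν : ℕ) (x : ℝ) : ℝ :=
  ((n + ν - 1).choose ν : ℝ) * x ^ ν / (1 + x) ^ (n + ν)

/-- A summable double series can be summed along antidiagonals. -/
theorem hasSum_sum_antidiagonal {F : ℕ × ℕ → ℝ} {a : ℝ} (hF : HasSum F a) :
    HasSum (fun k => ∑ p ∈ Finset.HasAntidiagonal.antidiagonal k, F p) a := by
  have h := (Finset.HasAntidiagonal.sigmaAntidiagonalEquivProd (A := ℕ)).hasSum_iff.mpr hF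
  refine h.sigma fun k => ?_
  rw [← Finset.sum_coe_sort]
  exact hasSum_fintype _

section RapidlyDecreasing

open PowerSeries

/-- A real power series with nonnegative coefficients whose coefficients are summable against
every power of `1 + k`. -/
def RapidlyDecreasing (P : ℝ⟦X⟧) : Prop :=
  (∀ k, 0 ≤ coeff k P) ∧ ∀ m : ℕ, Summable fun k : ℕ => coeff k P * (1 + (k : ℝ)) ^ m

namespace RapidlyDecreasing

variable {P Q : ℝ⟦X⟧}

/-- Products of coefficients are summable against powers of `1 + i + j`. -/
theorem summable_prod (hP : RapidlyDecreasing P) (hQ : RapidlyDecreasing Q) (m : ℕ) :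
    Summable fun p : ℕ × ℕ =>
      coeff p.1 P * coeff p.2 Q * (1 + ((p.1 + p.2 : ℕ) : ℝ)) ^ m := by
  have hP0 := hP.1
  have hQ0 := hQ.1
  refine Summable.of_nonneg_of_le
    (fun p => mul_nonneg (mul_nonneg (hP0 _) (hQ0 _)) (by positivity)) (fun p => ?_)
    ((hP.2 m).mul_of_nonneg (hQ.2 m) (fun k => mul_nonneg (hP0 _) (by positivity))
      (fun k => mul_nonneg (hQ0 _) (by positivity)))
  rw [mul_mul_mul_comm, ← mul_pow]
  have h : (0 : ℝ) ≤ (p.1 : ℝ) * p.2 := by positivity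
  refine mul_le_mul_of_nonneg_left ?_ (mul_nonneg (hP0 _) (hQ0 _))
  gcongr
  push_cast
  linarith

/-- Products of coefficients are summable against functions of polynomial growth. -/
theorem summable_prod_mul (hP : RapidlyDecreasing P) (hQ : RapidlyDecreasing Q) {f : ℕ → ℝ}
    {A : ℝ} {m : ℕ} (hf : ∀ k, |f k| ≤ A * (1 + (k : ℝ)) ^ m) :
    Summable fun p : ℕ × ℕ => coeff p.1 P * coeff p.2 Q * f (p.1 + p.2) := by
  refine Summable.of_norm_bounded ((hP.summable_prod hQ m).mul_left A) fun p => ?_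
  have h0 := mul_nonneg (hP.1 p.1) (hQ.1 p.2)
  rw [Real.norm_eq_abs, abs_mul, abs_of_nonneg h0]
  exact (mul_le_mul_of_nonneg_left (hf _) h0).trans_eq (by ring)

theorem summable_mul (hP : RapidlyDecreasing P) {f : ℕ → ℝ}
    {A : ℝ} {m : ℕ} (hf : ∀ k, |f k| ≤ A * (1 + (k : ℝ)) ^ m) :
    Summable fun k => coeff k P * f k := by
  refine Summable.of_norm_bounded ((hP.2 m).mul_left A) fun k => ?_
  rw [Real.norm_eq_abs, abs_mul, abs_of_nonneg (hP.1 k)]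
  exact (mul_le_mul_of_nonneg_left (hf _) (hP.1 k)).trans_eq (by ring)

theorem C {c : ℝ} (hc : 0 ≤ c) : RapidlyDecreasing (PowerSeries.C c) := by
  refine ⟨fun k => ?_, fun m => summable_of_ne_finset_zero (s := {0}) fun k hk => ?_⟩
  · rw [coeff_C]; split_ifs <;> simp [hc]
  · rw [coeff_C, if_neg (by simpa using hk), zero_mul]

theorem add (hP : RapidlyDecreasing P) (hQ : RapidlyDecreasing Q) :
    RapidlyDecreasing (P + Q) := by
  refine ⟨fun k => by simpa using add_nonneg (hP.1 k) (hQ.1 k), fun m => ?_⟩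
  simpa [add_mul] using (hP.2 m).add (hQ.2 m)

theorem mul (hP : RapidlyDecreasing P) (hQ : RapidlyDecreasing Q) :
    RapidlyDecreasing (P * Q) := by
  refine ⟨fun k => ?_, fun m => ?_⟩
  · rw [coeff_mul]
    exact Finset.sum_nonneg fun p _ => mul_nonneg (hP.1 _) (hQ.1 _)
  · refine (hasSum_sum_antidiagonal (hP.summable_prod hQ m).hasSum).summable.congr fun k => ?_
    rw [coeff_mul, Finset.sum_mul]
    exact Finset.sum_congr rfl fun p hp => by rw [Finset.HasAntidiagonal.mem_antidiagonal.mp hp]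

theorem pow (hP : RapidlyDecreasing P) (n : ℕ) : RapidlyDecreasing (P ^ n) := by
  induction n with
  | zero => simpa using C zero_le_one
  | succ n ih => rw [pow_succ]; exact ih.mul hP

theorem sum {ι : Type*} {s : Finset ι} {P : ι → ℝ⟦X⟧} (hP : ∀ i ∈ s, RapidlyDecreasing (P i)) :
    RapidlyDecreasing (∑ i ∈ s, P i) :=
  Finset.sum_induction P RapidlyDecreasing (fun _ _ => add) (by simpa using C le_rfl) hP

/-- Geometric series are rapidly decreasing. -/
theorem rescale_mk_one {r : ℝ} (h0 : 0 ≤ r) (h1 : r < 1) :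
    RapidlyDecreasing (rescale r (mk 1)) := by
  refine ⟨fun k => by simpa using pow_nonneg h0 k, fun m => ?_⟩
  have hr : ‖r‖ < 1 := by rwa [Real.norm_of_nonneg h0]
  have h : Summable fun k : ℕ =>
      ∑ i ∈ Finset.range (m + 1), (m.choose i : ℝ) * ((k : ℝ) ^ i * r ^ k) :=
    summable_sum fun i _ => (summable_pow_mul_geometric_of_norm_lt_one i hr).mul_left _
  refine h.congr fun k => ?_
  rw [add_comm (1 : ℝ), add_pow, Finset.mul_sum]
  refine Finset.sum_congr rfl fun i _ => ?_
  simp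
  ring

end RapidlyDecreasing

/-- Summation by parts: a second difference of a rapidly decreasing series with nonnegative
coefficients pairs nonnegatively with a convex sequence. -/
theorem tsum_coeff_one_sub_X_sq_mul_nonneg {T : ℝ⟦X⟧} (hT : RapidlyDecreasing T) {f : ℕ → ℝ}
    (hconv : ∀ k, 2 * f (k + 1) ≤ f k + f (k + 2))
    {A : ℝ} {m : ℕ} (hA : 0 ≤ A) (hf : ∀ k, |f k| ≤ A * (1 + (k : ℝ)) ^ m) :
    0 ≤ ∑' k, coeff k ((1 - X) ^ 2 * T) * f k := by
  have hshift (j : ℕ) : Summable fun k => coeff k T * f (k + j) := by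
    refine hT.summable_mul (A := A * (1 + j) ^ m) (m := m) fun k => (hf _).trans ?_
    rw [mul_assoc, ← mul_pow]
    have h : (0 : ℝ) ≤ (k : ℝ) * j := by positivity
    gcongr
    push_cast
    linarith
  have hX (j : ℕ) : HasSum (fun k => coeff k (X ^ j * T) * f k) (∑' k, coeff k T * f (k + j)) := by
    rw [← hasSum_nat_add_iff' j, Finset.sum_eq_zero fun i hi => ?_, sub_zero]
    · simpa [coeff_X_pow_mul] using (hshift j).hasSum
    · rw [coeff_X_pow_mul', if_neg (by simpa using hi), zero_mul]
  have hD : HasSum (fun k => coeff k ((1 - X) ^ 2 * T) * f k)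
      (∑' k, coeff k T * f (k + 0) - 2 * ∑' k, coeff k T * f (k + 1)
        + ∑' k, coeff k T * f (k + 2)) := by
    refine (((hX 0).sub ((hX 1).mul_left 2)).add (hX 2)).congr_fun fun k => ?_
    rw [show (1 - X) ^ 2 * T = X ^ 0 * T - (X ^ 1 * T + X ^ 1 * T) + X ^ 2 * T by ring]
    simp only [map_add, map_sub]
    ring
  rw [hD.tsum_eq, ← tsum_mul_left, ← ((hshift 0).tsum_sub ((hshift 1).mul_left 2)),
    ← (((hshift 0).sub ((hshift 1).mul_left 2)).tsum_add (hshift 2))]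
  refine tsum_nonneg fun k => ?_
  have h := mul_nonneg (hT.1 k) (sub_nonneg.mpr (hconv k))
  simp only [add_zero]
  linarith

/-- The generating function `1 / (1 + x - x X)` of the Baskakov basis functions with `n = 1`. -/
noncomputable def baskakovGen (x : ℝ) : ℝ⟦X⟧ :=
  C (1 + x)⁻¹ * rescale (x / (1 + x)) (mk 1)

theorem coeff_baskakovGen_pow {n : ℕ} (hn : 1 ≤ n) {x : ℝ} (k : ℕ) :
    coeff k (baskakovGen x ^ n) = baskakovBasis n k x := by
  obtain ⟨d, rfl⟩ := Nat.exists_eq_add_of_le' hn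
  rw [baskakovGen, mul_pow, ← map_pow, ← map_pow, coeff_C_mul, coeff_rescale,
    mk_one_pow_eq_mk_choose_add, coeff_mk, baskakovBasis, show d + 1 + k - 1 = d + k by omega,
    Nat.choose_symm_add, pow_add (1 + x), pow_succ (1 + x)]
  simp only [div_eq_mul_inv, mul_pow, mul_inv, ← inv_pow]
  ring

theorem rapidlyDecreasing_baskakovGen {x : ℝ} (hx : 0 ≤ x) :
    RapidlyDecreasing (baskakovGen x) :=
  (RapidlyDecreasing.C (by positivity)).mul
    (RapidlyDecreasing.rescale_mk_one (by positivity) (by rw [div_lt_one] <;> linarith))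

theorem baskakovGen_mul {x : ℝ} (hx : 0 ≤ x) :
    baskakovGen x * (C (1 + x) - C x * X) = 1 := by
  have h0 : 1 + x ≠ 0 := by positivity
  have h := congrArg (rescale (x / (1 + x))) (mk_one_mul_one_sub_eq_one ℝ)
  rw [map_mul, map_sub, map_one, rescale_X] at h
  have h1 : (C (1 + x)⁻¹ : ℝ⟦X⟧) * C (1 + x) = 1 := by
    rw [← map_mul, inv_mul_cancel₀ h0, map_one]
  have h2 : (C (1 + x)⁻¹ : ℝ⟦X⟧) * C x = C (x / (1 + x)) := by
    rw [← map_mul, inv_mul_eq_div]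
  rw [baskakovGen, ← h]
  linear_combination rescale (x / (1 + x)) (mk 1) * (h1 - X * h2)

theorem baskakovGen_sub {x y : ℝ} (hx : 0 ≤ x) (hy : 0 ≤ y) :
    baskakovGen x - baskakovGen y = C (y - x) * (1 - X) * (baskakovGen x * baskakovGen y) := by
  have h1 := baskakovGen_mul hx
  have h2 := baskakovGen_mul hy
  simp only [map_add, map_sub, map_one] at *
  linear_combination baskakovGen y * h1 - baskakovGen x * h2

/-- The squared difference of two Baskakov generating functions is `(1 - X) ^ 2` times a rapidly
decreasing series. -/
theorem exists_baskakovGen_pow_sub_sq (n : ℕ) {x y : ℝ} (hx : 0 ≤ x) (hy : 0 ≤ y) :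
    ∃ T, RapidlyDecreasing T ∧
      (baskakovGen x ^ n - baskakovGen y ^ n) ^ 2 = (1 - X) ^ 2 * T := by
  have hGx := rapidlyDecreasing_baskakovGen hx
  have hGy := rapidlyDecreasing_baskakovGen hy
  refine ⟨C ((y - x) ^ 2) *
    ((∑ i ∈ Finset.range n, baskakovGen x ^ i * baskakovGen y ^ (n - 1 - i))
    * (baskakovGen x * baskakovGen y)) ^ 2, ?_, ?_⟩
  · exact (RapidlyDecreasing.C (sq_nonneg _)).mul
      (((RapidlyDecreasing.sum fun i _ => (hGx.pow i).mul (hGy.pow _)).mul (hGx.mul hGy)).pow 2)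
  · rw [← (Commute.all _ _).geom_sum₂_mul, baskakovGen_sub hx hy, map_pow]
    ring

end RapidlyDecreasing

theorem rasa_inequality_baskakov (n : ℕ) (hn : 1 ≤ n) (f : ℝ → ℝ)
    (hf_cont : ContinuousOn f (Set.Ici 0)) (hf_conv : ConvexOn ℝ (Set.Ici 0) f)
    (hf_growth : ∃ A : ℝ, ∃ m : ℕ, 0 < A ∧ ∀ t : ℝ, 0 ≤ t → |f t| ≤ A * (1 + t) ^ m)
    (x y : ℝ) (hx : 0 ≤ x) (hy : 0 ≤ y) :
    0 ≤ ∑' (i : ℕ), ∑' (j : ℕ),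
      (baskakovBasis n i x * baskakovBasis n j x + baskakovBasis n i y * baskakovBasis n j y
        - 2 * baskakovBasis n i x * baskakovBasis n j y) * f (i + j : ℕ) := by
  obtain ⟨A, m, hA, hf⟩ := hf_growth
  have hf' (k : ℕ) : |f k| ≤ A * (1 + (k : ℝ)) ^ m := hf k k.cast_nonneg
  have hconv (k : ℕ) : 2 * f (k + 1 : ℕ) ≤ f k + f (k + 2 : ℕ) := by
    have h := hf_conv.2 (Set.mem_Ici.mpr k.cast_nonneg) (Set.mem_Ici.mpr (k + 2).cast_nonneg)
      (one_half_pos (α := ℝ)).le (one_half_pos (α := ℝ)).le (add_halves 1)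
    rw [show (1 / 2 : ℝ) • (k : ℝ) + (1 / 2 : ℝ) • ((k + 2 : ℕ) : ℝ) = (k + 1 : ℕ) by
      push_cast; simp only [smul_eq_mul]; ring] at h
    simp only [smul_eq_mul] at h
    linarith
  have hPx := (rapidlyDecreasing_baskakovGen hx).pow n
  have hPy := (rapidlyDecreasing_baskakovGen hy).pow n
  obtain ⟨T, hT, hTeq⟩ := exists_baskakovGen_pow_sub_sq n hx hy
  simp only [← coeff_baskakovGen_pow hn]
  generalize baskakovGen x ^ n = P at *
  generalize baskakovGen y ^ n = Q at *
  have hS : Summable fun p : ℕ × ℕ =>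
      (PowerSeries.coeff p.1 P * PowerSeries.coeff p.2 P
        + PowerSeries.coeff p.1 Q * PowerSeries.coeff p.2 Q
      - 2 * PowerSeries.coeff p.1 P * PowerSeries.coeff p.2 Q) * f (p.1 + p.2 : ℕ) := by
    refine (((hPx.summable_prod_mul hPx hf').add (hPy.summable_prod_mul hPy hf')).sub
      ((hPx.summable_prod_mul hPy hf').mul_left 2)).congr fun p => ?_
    ring
  rw [← hS.tsum_prod, ← (hasSum_sum_antidiagonal hS.hasSum).tsum_eq]
  refine (tsum_coeff_one_sub_X_sq_mul_nonneg hT hconv hA.le hf').trans_eq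
    (tsum_congr fun k => ?_)
  rw [← hTeq, show (P - Q) ^ 2 = P * P + Q * Q - (P * Q + P * Q) by ring]
  simp only [map_sub, map_add, PowerSeries.coeff_mul, ← Finset.sum_add_distrib,
    ← Finset.sum_sub_distrib,
    Finset.sum_mul]
  refine Finset.sum_congr rfl fun p hp => ?_
  rw [Finset.HasAntidiagonal.mem_antidiagonal.mp hp]
  ring
end

section
/- Let n ≥ 1 and k be natural numbers and let x, y ≥ 0. Then ∑_{i=0}^{k} b_{n,i}(x) b_{n,k−i}(y) = (1/k!) · [(d/dz)^k ((1−xz)^{−n} (1−yz)^{−n})] evaluated at z = −1. -/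
/-- The `i`-th derivative of `z ↦ (1 - x z)^{-n}` away from its pole. -/
lemma iteratedDeriv_one_sub_mul_zpow_neg (n i : ℕ) (x : ℝ) {z : ℝ} (hz : 1 - x * z ≠ 0) :
    iteratedDeriv i (fun z : ℝ => (1 - x * z) ^ (-(n : ℤ))) z
      = (n.ascFactorial i : ℝ) * x ^ i * (1 - x * z) ^ (-((n + i : ℕ) : ℤ)) := by
  induction i generalizing z with
  | zero => simp
  | succ i ih =>
    have hev : iteratedDeriv i (fun z : ℝ => (1 - x * z) ^ (-(n : ℤ))) =ᶠ[nhds z]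
        fun z => (n.ascFactorial i : ℝ) * x ^ i * (1 - x * z) ^ (-((n + i : ℕ) : ℤ)) := by
      have hc : ContinuousAt (fun z : ℝ => 1 - x * z) z := by fun_prop
      filter_upwards [hc.eventually_ne hz] with w hw using ih hw
    have hd : HasDerivAt (fun z : ℝ => 1 - x * z) (-x) z := by
      simpa using ((hasDerivAt_id z).const_mul x).const_sub 1
    have hp := ((hasDerivAt_zpow (-((n + i : ℕ) : ℤ)) (1 - x * z) (Or.inl hz)).comp z hd).const_mul
      ((n.ascFactorial i : ℝ) * x ^ i)
    rw [iteratedDeriv_succ, hev.deriv_eq]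
    refine hp.deriv.trans ?_
    rw [show -((n + i : ℕ) : ℤ) - 1 = -((n + (i + 1) : ℕ) : ℤ) by push_cast; ring,
      Nat.ascFactorial_succ]
    push_cast
    ring

lemma contDiffAt_one_sub_mul_zpow_neg (n : ℕ) (k : WithTop ℕ∞) (x : ℝ) {z : ℝ}
    (hz : 1 - x * z ≠ 0) :
    ContDiffAt ℝ k (fun z : ℝ => (1 - x * z) ^ (-(n : ℤ))) z := by
  simp only [zpow_neg, zpow_natCast]
  exact ContDiffAt.inv (by fun_prop) (pow_ne_zero n hz)

/-- The Baskakov basis functions are the normalised derivatives of `z ↦ (1 - x z)^{-n}`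
at `z = -1`. -/
lemma iteratedDeriv_eq_factorial_mul_baskakovBasis (n i : ℕ) {x : ℝ} (hx : 0 ≤ x) :
    iteratedDeriv i (fun z : ℝ => (1 - x * z) ^ (-(n : ℤ))) (-1)
      = (i.factorial : ℝ) * baskakovBasis n i x := by
  have hz : 1 - x * (-1) ≠ 0 := by linarith
  rw [iteratedDeriv_one_sub_mul_zpow_neg _ _ _ hz, Nat.ascFactorial_eq_factorial_mul_choose',
    baskakovBasis, show 1 - x * (-1) = 1 + x by ring, zpow_neg, zpow_natCast]
  push_cast
  ring

theorem baskakov_convolution_eq_iteratedDeriv (n : ℕ) (hn : 1 ≤ n) (k : ℕ)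
    (x y : ℝ) (hx : 0 ≤ x) (hy : 0 ≤ y) :
    ∑ i ∈ Finset.range (k + 1), baskakovBasis n i x * baskakovBasis n (k - i) y
      = (1 / (Nat.factorial k : ℝ)) *
        iteratedDeriv k
          (fun z : ℝ => (1 - x * z) ^ (-(n : ℤ)) * (1 - y * z) ^ (-(n : ℤ))) (-1) := by
  have hx' : 1 - x * (-1) ≠ 0 := by linarith
  have hy' : 1 - y * (-1) ≠ 0 := by linarith
  rw [iteratedDeriv_fun_mul (contDiffAt_one_sub_mul_zpow_neg n k x hx')
    (contDiffAt_one_sub_mul_zpow_neg n k y hy'), Finset.mul_sum]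
  refine Finset.sum_congr rfl fun i hi => ?_
  have hik : i ≤ k := Nat.lt_succ_iff.mp (Finset.mem_range.mp hi)
  rw [iteratedDeriv_eq_factorial_mul_baskakovBasis n i hx,
    iteratedDeriv_eq_factorial_mul_baskakovBasis n (k - i) hy,
    ← Nat.choose_mul_factorial_mul_factorial hik]
  have hc : (k.choose i : ℝ) ≠ 0 := Nat.cast_ne_zero.mpr (Nat.choose_pos hik).ne'
  have hi' : (i.factorial : ℝ) ≠ 0 := Nat.cast_ne_zero.mpr i.factorial_ne_zero
  have hk : ((k - i).factorial : ℝ) ≠ 0 := Nat.cast_ne_zero.mpr (k - i).factorial_ne_zero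
  push_cast
  field_simp
end

section
/- Let n ≥ 1 be a natural number and let x, y ≥ 0. Define g on a neighborhood of z = −1 by g(z) = (((1−xz)^{−n} − (1−yz)^{−n})/z)^2. Then for every natural number k, the k-th derivative of g at z = −1 satisfies g^{(k)}(−1) ≥ 0. -/
open scoped ContDiff Topology

/-- A real function is smooth at `a` and all its iterated derivatives at `a` are nonnegative. -/
def AbsolutelyMonotoneAt (f : ℝ → ℝ) (a : ℝ) : Prop :=
  ContDiffAt ℝ ∞ f a ∧ ∀ k : ℕ, 0 ≤ iteratedDeriv k f a

namespace AbsolutelyMonotoneAt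

variable {f g : ℝ → ℝ} {a c : ℝ}

theorem const (hc : 0 ≤ c) : AbsolutelyMonotoneAt (fun _ ↦ c) a := by
  refine ⟨contDiffAt_const, fun k ↦ ?_⟩
  rw [iteratedDeriv_const]
  split_ifs
  exacts [hc, le_rfl]

theorem add (hf : AbsolutelyMonotoneAt f a) (hg : AbsolutelyMonotoneAt g a) :
    AbsolutelyMonotoneAt (f + g) a := by
  refine ⟨hf.1.add hg.1, fun k ↦ ?_⟩
  rw [iteratedDeriv_add (hf.1.of_le (mod_cast le_top)) (hg.1.of_le (mod_cast le_top))]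
  exact add_nonneg (hf.2 k) (hg.2 k)

theorem mul (hf : AbsolutelyMonotoneAt f a) (hg : AbsolutelyMonotoneAt g a) :
    AbsolutelyMonotoneAt (f * g) a := by
  refine ⟨hf.1.mul hg.1, fun k ↦ ?_⟩
  rw [iteratedDeriv_mul (hf.1.of_le (mod_cast le_top)) (hg.1.of_le (mod_cast le_top))]
  exact Finset.sum_nonneg fun i _ ↦
    mul_nonneg (mul_nonneg (Nat.cast_nonneg _) (hf.2 i)) (hg.2 (k - i))

theorem pow (hf : AbsolutelyMonotoneAt f a) (m : ℕ) : AbsolutelyMonotoneAt (f ^ m) a := by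
  induction m with
  | zero => exact const zero_le_one
  | succ m ih => exact pow_succ f m ▸ ih.mul hf

theorem sum {ι : Type*} (s : Finset ι) {F : ι → ℝ → ℝ}
    (hF : ∀ i ∈ s, AbsolutelyMonotoneAt (F i) a) : AbsolutelyMonotoneAt (∑ i ∈ s, F i) a :=
  Finset.sum_induction F (AbsolutelyMonotoneAt · a) (fun _ _ ↦ add) (const le_rfl) hF

theorem inv_one_sub_mul (hc : 0 ≤ c) (hca : 0 < 1 - c * a) :
    AbsolutelyMonotoneAt (fun z ↦ (1 - c * z)⁻¹) a := by
  refine ⟨ContDiffAt.inv (by fun_prop) hca.ne', fun k ↦ ?_⟩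
  have h : (fun z ↦ (1 - c * z)⁻¹) = fun z ↦ (-c * z + 1)⁻¹ := by
    ext z
    ring_nf
  rw [h, iteratedDeriv_eq_iterate, iter_deriv_inv_linear]
  beta_reduce
  rw [mul_right_comm ((-1) ^ k), ← mul_pow]
  have hca' : 0 < -c * a + 1 := by linarith
  have hc' : 0 ≤ -1 * -c := by linarith
  positivity

end AbsolutelyMonotoneAt

theorem inv_pow_sub_inv_pow_div {x y z : ℝ} (hz : z ≠ 0) (hx : 1 - x * z ≠ 0)
    (hy : 1 - y * z ≠ 0) (n : ℕ) :
    ((1 - x * z)⁻¹ ^ n - (1 - y * z)⁻¹ ^ n) / z =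
      (x - y) * ((1 - x * z)⁻¹ * (1 - y * z)⁻¹ *
        ∑ i ∈ Finset.range n, (1 - x * z)⁻¹ ^ i * (1 - y * z)⁻¹ ^ (n - 1 - i)) := by
  have h : (1 - x * z)⁻¹ - (1 - y * z)⁻¹ =
      (x - y) * z * ((1 - x * z)⁻¹ * (1 - y * z)⁻¹) := by
    rw [inv_sub_inv hx hy, ← mul_inv, ← div_eq_mul_inv]
    ring
  rw [← geom_sum₂_mul, h, div_eq_iff hz]
  ring

theorem baskakov_g_deriv_nonneg (n : ℕ) (hn : 1 ≤ n) (x y : ℝ) (hx : 0 ≤ x) (hy : 0 ≤ y)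
    (g : ℝ → ℝ)
    (hg : ∀ z : ℝ, g z =
        (((1 - x * z) ^ (-(n : ℤ)) - (1 - y * z) ^ (-(n : ℤ))) / z) ^ 2) :
    ∀ k : ℕ, 0 ≤ iteratedDeriv k g (-1) := by
  intro k
  let u : ℝ → ℝ := fun z ↦ (1 - x * z)⁻¹
  let v : ℝ → ℝ := fun z ↦ (1 - y * z)⁻¹
  have hu : AbsolutelyMonotoneAt u (-1) := .inv_one_sub_mul hx (by linarith)
  have hv : AbsolutelyMonotoneAt v (-1) := .inv_one_sub_mul hy (by linarith)
  have key : AbsolutelyMonotoneAt ((fun _ ↦ (x - y) ^ 2) *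
      (u * v * ∑ i ∈ Finset.range n, u ^ i * v ^ (n - 1 - i)) ^ 2) (-1) :=
    (AbsolutelyMonotoneAt.const (sq_nonneg _)).mul
      (((hu.mul hv).mul (.sum _ fun i _ ↦ (hu.pow i).mul (hv.pow _))).pow 2)
  refine (key.2 k).trans_eq (Filter.EventuallyEq.iteratedDeriv_eq k ?_)
  filter_upwards [Iio_mem_nhds (show (-1 : ℝ) < 0 by norm_num)] with z hz
  have hz : z < 0 := hz
  have hxz : 1 - x * z ≠ 0 := by nlinarith
  have hyz : 1 - y * z ≠ 0 := by nlinarith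
  rw [hg, zpow_neg, zpow_neg, zpow_natCast, zpow_natCast, ← inv_pow, ← inv_pow,
    inv_pow_sub_inv_pow_div hz.ne hxz hyz]
  simp [u, v, mul_pow]
end
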